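/- Define the perturbed kernel K(z) := (1 + a(z))|z|^{−(N+2s)} and Γ*(x) := min{|x|^{−(N−2s)}, R^{−(N−2s)}}. Then for every nonnegative smooth function φ compactly supported in ℝ^N ∖ B̄_R, ∫_{ℝ^N}∫_{ℝ^N} (Γ*(x)−Γ*(y))(φ(x)−φ(y)) K(x−y) dx dy ≥ 0; that is, K satisfies hypothesis (K5). -/

import Mathlib

open MeasureTheory Filter Topology

noncomputable section

/-- The truncated fundamental solution `Γ*(x) = min{|x|^{−(N−2s)}, R^{−(N−2s)}}`. -/
def Gammastar (N : ℕ) (s R : ℝ) (x : EuclideanSpace ℝ (Fin N)) : ℝ :=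
  min (‖x‖ ^ (-((N : ℝ) - 2 * s))) (R ^ (-((N : ℝ) - 2 * s)))


lemma inv_det (N : ℕ) (y : EuclideanSpace ℝ (Fin N)) (c : ℝ) (hc : 0 ≤ c) :
    |(c ^ 2 • ((ℝ ∙ y)ᗮ.reflection : EuclideanSpace ℝ (Fin N) →L[ℝ] EuclideanSpace ℝ (Fin N))).det| =
      c ^ (2 * (N:ℝ)) := by
  have h := congrArg abs ((ℝ ∙ y)ᗮ.det_reflection)
  have h2 : |LinearMap.det (((ℝ ∙ y)ᗮ.reflection : EuclideanSpace ℝ (Fin N) →L[ℝ] EuclideanSpace ℝ (Fin N)) : EuclideanSpace ℝ (Fin N) →ₗ[ℝ] EuclideanSpace ℝ (Fin N))| = 1 := by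
    refine Eq.trans h ?_
    simp
  rw [ContinuousLinearMap.det, ContinuousLinearMap.toLinearMap_smul, LinearMap.det_smul, abs_mul, h2]
  simp only [finrank_euclideanSpace, Fintype.card_fin, mul_one]
  rw [Real.rpow_mul hc, Real.rpow_natCast, abs_of_nonneg (by positivity)]
  norm_cast

set_option maxHeartbeats 1600000 in
lemma inv_identity (N : ℕ) (hN : 0 < N) (α q : ℝ) (hq : q = 2 * N - α)
    (x : EuclideanSpace ℝ (Fin N)) (hx : x ≠ 0) (l : ℝ) (hl : 1 < l) :
    ∫ y in {y : EuclideanSpace ℝ (Fin N) | l * ‖y‖ < ‖x‖},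
      (‖x‖ ^ (-α) - ‖y‖ ^ (-α)) * ‖x - y‖ ^ (-q) =
    - ∫ y in {y : EuclideanSpace ℝ (Fin N) | l * ‖x‖ < ‖y‖},
      (‖x‖ ^ (-α) - ‖y‖ ^ (-α)) * ‖x - y‖ ^ (-q) := by
  have : Nonempty (Fin N) := ⟨⟨0, hN⟩⟩
  have hr : 0 < ‖x‖ := norm_pos_iff.2 hx
  have hl0 : 0 < l := by linarith
  set O : Set (EuclideanSpace ℝ (Fin N)) := {y | l * ‖x‖ < ‖y‖} with hO
  set I : Set (EuclideanSpace ℝ (Fin N)) := {y | l * ‖y‖ < ‖x‖} with hI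
  have hOm : MeasurableSet O := measurableSet_lt (by fun_prop) (by fun_prop)
  have hO0 : ∀ y ∈ O, 0 < ‖y‖ := fun y hy => lt_trans (by positivity) hy
  let T := EuclideanGeometry.inversion (0 : EuclideanSpace ℝ (Fin N)) ‖x‖
  have hTn : ∀ y, ‖T y‖ = ‖x‖ ^ 2 / ‖y‖ := by
    intro y
    have := EuclideanGeometry.dist_inversion_center (0 : EuclideanSpace ℝ (Fin N)) y ‖x‖
    simpa [dist_zero_right] using this
  have hTx : T x = x := by
    apply EuclideanGeometry.inversion_of_mem_sphere; simp
  have hTd : ∀ y, y ≠ 0 → ‖x - T y‖ = ‖x‖ / ‖y‖ * ‖x - y‖ := by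
    intro y hy
    have := EuclideanGeometry.dist_inversion_inversion hx hy ‖x‖
    change dist (T x) (T y) = _ at this
    rw [hTx, dist_eq_norm, dist_zero_right, dist_zero_right, dist_eq_norm] at this
    rw [this]; field_simp
  have himg : T '' O = I \ {0} := by
    ext z
    constructor
    · rintro ⟨y, hy, rfl⟩
      have h0 := hO0 y hy
      have hTy : 0 < ‖T y‖ := by rw [hTn]; positivity
      refine ⟨?_, ?_⟩
      · change l * ‖T y‖ < ‖x‖
        rw [hTn, mul_div_assoc', div_lt_iff₀ h0]
        have : l * ‖x‖ < ‖y‖ := hy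
        nlinarith
      · simpa using norm_pos_iff.1 hTy
    · rintro ⟨hz, hz0⟩
      have hz0' : 0 < ‖z‖ := norm_pos_iff.2 (by simpa using hz0)
      refine ⟨T z, ?_, EuclideanGeometry.inversion_inversion _ hr.ne' z⟩
      change l * ‖x‖ < ‖T z‖
      rw [hTn, lt_div_iff₀ hz0']
      have : l * ‖z‖ < ‖x‖ := hz
      nlinarith
  have hae : (I : Set _) =ᵐ[volume] (I \ {0} : Set _) := by
    refine (sdiff_null_ae_eq_self ?_).symm
    simp
  rw [setIntegral_congr_set hae, ← himg]
  rw [integral_image_eq_integral_abs_det_fderiv_smul volume hOm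
    (f' := fun y => (‖x‖ / dist y 0) ^ 2 • ((ℝ ∙ (y - 0))ᗮ.reflection : EuclideanSpace ℝ (Fin N) →L[ℝ] EuclideanSpace ℝ (Fin N)))
    (fun y hy => (EuclideanGeometry.hasFDerivAt_inversion
      (norm_pos_iff.1 (hO0 y hy))).hasFDerivWithinAt)
    ((EuclideanGeometry.inversion_injective _ hr.ne').injOn), ← integral_neg]
  apply setIntegral_congr_fun hOm
  intro y hy
  have h0 := hO0 y hy
  have hy0 := norm_pos_iff.1 h0
  simp only [smul_eq_mul]
  rw [inv_det N _ _ (by positivity)]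
  rw [dist_zero_right]
  rw [hTn, hTd y hy0, Real.mul_rpow (by positivity) (by positivity)]
  have e1 : (‖x‖ / ‖y‖) ^ (2 * (N:ℝ)) * (‖x‖ / ‖y‖) ^ (-q) = ‖x‖ ^ α * ‖y‖ ^ (-α) := by
    rw [← Real.rpow_add (by positivity), hq, show 2 * (N:ℝ) + -(2 * N - α) = α by ring,
      Real.div_rpow hr.le h0.le, Real.rpow_neg h0.le]; rfl
  have e2 : (‖x‖ ^ 2 / ‖y‖) ^ (-α) = ‖x‖ ^ (-α) * ‖x‖ ^ (-α) * ‖y‖ ^ α := by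
    rw [Real.div_rpow (by positivity) h0.le, Real.rpow_neg h0.le, pow_two, Real.mul_rpow hr.le hr.le]
    field_simp
  have e3 : ‖x‖ ^ α * ‖x‖ ^ (-α) = 1 := by rw [← Real.rpow_add hr]; simp
  have e4 : ‖y‖ ^ α * ‖y‖ ^ (-α) = 1 := by rw [← Real.rpow_add h0]; simp
  rw [e2]
  calc _ = ((‖x‖ / ‖y‖) ^ (2 * (N:ℝ)) * (‖x‖ / ‖y‖) ^ (-q)) * (‖x‖ ^ (-α) - ‖x‖ ^ (-α) * ‖x‖ ^ (-α) * ‖y‖ ^ α) * ‖x - y‖ ^ (-q) := by ring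
    _ = ((‖x‖ ^ α * ‖x‖ ^ (-α)) * ‖y‖ ^ (-α) - (‖x‖ ^ α * ‖x‖ ^ (-α)) * ‖x‖ ^ (-α) * (‖y‖ ^ α * ‖y‖ ^ (-α))) * ‖x - y‖ ^ (-q) := by rw [e1]; ring
    _ = _ := by rw [e3, e4]; ring


lemma integ_ball {N : ℕ} (R : ℝ) (f : EuclideanSpace ℝ (Fin N) → ℝ)
    (hf : ContinuousOn f (Metric.closedBall 0 R)) (h0 : ∀ z, R < ‖z‖ → f z = 0) :
    Integrable f := by
  rw [← integrableOn_iff_integrable_of_support_subset (s := Metric.closedBall 0 R)]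
  · exact hf.integrableOn_compact (isCompact_closedBall _ _)
  · intro z hz
    by_contra h
    exact hz (h0 z (by simpa using h))

lemma A_V (w : ℝ → ℝ) (hw : Continuous w) (hw0 : ∀ u, 0 ≤ w u) (Q : ℝ)
    (hwQ : ∀ u, Q ≤ u → w u = 0) :
    ∃ V : ℝ → ℝ, (∀ u, HasDerivAt V (-(w u / 2)) u) ∧ (∀ u, 0 ≤ V u) ∧ ∀ u, Q ≤ u → V u = 0 := by
  have hz : ∀ u, Q ≤ u → ∫ v in u..Q, w v / 2 = 0 := by
    intro u hu
    rw [intervalIntegral.integral_symm, intervalIntegral.integral_congr (g := fun _ => 0)]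
    · simp
    · intro v hv
      rw [Set.uIcc_of_le hu] at hv
      simp [hwQ v hv.1]
  refine ⟨fun u => ∫ v in u..Q, w v / 2, fun u => ?_, fun u => ?_, hz⟩
  · have hc : Continuous fun v => w v / 2 := by fun_prop
    exact intervalIntegral.integral_hasDerivAt_left (hc.intervalIntegrable _ _)
      (hc.stronglyMeasurableAtFilter _ _) hc.continuousAt
  · rcases le_total u Q with h | h
    · exact intervalIntegral.integral_nonneg h fun v _ => by have := hw0 v; positivity
    · exact (hz u h).ge

set_option maxHeartbeats 1000000 in
lemma A1 {N : ℕ} (α : ℝ) (hα0 : 0 ≤ α) (hα : (N : ℝ) - 2 ≤ α) (R : ℝ) (hR : 0 < R)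
    (x : EuclideanSpace ℝ (Fin N)) (t : ℝ) (ht : 0 ≤ t)
    (hx : ∀ z : EuclideanSpace ℝ (Fin N), ‖z‖ ≤ R → x + t • z ≠ 0)
    (w : ℝ → ℝ) (hw : Continuous w) (hw0 : ∀ u, 0 ≤ w u)
    (hwR : ∀ u, R ^ 2 ≤ u → w u = 0) :
    0 ≤ ∫ z : EuclideanSpace ℝ (Fin N), w (‖z‖ ^ 2) *
      (-α * inner ℝ z (x + t • z) * (‖x + t • z‖ ^ 2) ^ (-α / 2 - 1)) := by
  obtain ⟨V, hV, hV0, hVR⟩ := A_V w hw hw0 (R ^ 2) hwR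
  have hVc : Continuous V := continuous_iff_continuousAt.2 fun u => (hV u).continuousAt
  let W : EuclideanSpace ℝ (Fin N) → ℝ := fun z => V (‖z‖ ^ 2)
  have hWc : Continuous W := by fun_prop
  have hWR : ∀ z, R ≤ ‖z‖ → W z = 0 := fun z hz => hVR _ (by gcongr)
  have hwR' : ∀ z : EuclideanSpace ℝ (Fin N), R ≤ ‖z‖ → w (‖z‖ ^ 2) = 0 := fun z hz => hwR _ (by gcongr)
  have hWts : tsupport W ⊆ Metric.closedBall 0 R := by
    apply closure_minimal _ Metric.isClosed_closedBall
    intro z hz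
    by_contra h
    exact hz (hWR z (by have : R < ‖z‖ := by simpa using h
                        exact this.le))
  have hWd : ∀ z, HasFDerivAt W (-(w (‖z‖ ^ 2) / 2) • (2 • (innerSL ℝ z))) z := by
    intro z
    have h1 : HasFDerivAt (fun z : EuclideanSpace ℝ (Fin N) => ‖z‖ ^ 2) (2 • (innerSL ℝ z)) z := by
      simpa using (hasStrictFDerivAt_norm_sq z).hasFDerivAt
    exact (hV _).comp_hasFDerivAt z h1
  let p : EuclideanSpace ℝ (Fin N) → ℝ := fun z => -α * (‖x + t • z‖ ^ 2) ^ (-α / 2 - 1)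
  let p2 : EuclideanSpace ℝ (Fin N) → ℝ := fun z =>
    α * (α + 2) * (‖x + t • z‖ ^ 2) ^ (-α / 2 - 1 - 1)
  have hpos : ∀ z : EuclideanSpace ℝ (Fin N), ‖z‖ ≤ R → 0 < ‖x + t • z‖ ^ 2 := by
    intro z hz
    have := norm_pos_iff.2 (hx z hz)
    positivity
  have hcon : ∀ β : ℝ, ContinuousOn (fun z : EuclideanSpace ℝ (Fin N) => (‖x + t • z‖ ^ 2) ^ β)
      (Metric.closedBall 0 R) := by
    intro β
    apply ContinuousOn.rpow_const
    · fun_prop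
    · intro z hz
      exact Or.inl (hpos z (by simpa using hz)).ne'
  have hpc : ContinuousOn p (Metric.closedBall 0 R) := (hcon _).const_mul _ 
  have hp2c : ContinuousOn p2 (Metric.closedBall 0 R) := (hcon _).const_mul _
  let e : Fin N → EuclideanSpace ℝ (Fin N) := fun i => EuclideanSpace.single i 1
  let g : Fin N → EuclideanSpace ℝ (Fin N) → ℝ := fun i z => (x i + t * z i) * p z
  have hinner : ∀ (z : EuclideanSpace ℝ (Fin N)) i, inner ℝ z (e i) = z i := by
    intro z i
    simp [e, EuclideanSpace.inner_single_right]
  have hgd : ∀ i z, ‖z‖ ≤ R → DifferentiableAt ℝ (g i) z ∧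
      fderiv ℝ (g i) z (e i) = t * (p z + (x i + t * z i) ^ 2 * p2 z) := by
    intro i z hz
    have h0 : HasFDerivAt (fun z : EuclideanSpace ℝ (Fin N) => x + t • z)
        (t • ContinuousLinearMap.id ℝ _) z := by
      simpa using ((hasFDerivAt_id z).const_smul t).const_add x
    have h1 := h0.norm_sq.rpow_const (p := -α / 2 - 1) (Or.inl (hpos z hz).ne')
    have h2 := h1.const_mul (-α)
    have h3 : HasFDerivAt (fun z : EuclideanSpace ℝ (Fin N) => x i + t * z i)
        (t • (EuclideanSpace.proj i : EuclideanSpace ℝ (Fin N) →L[ℝ] ℝ)) z := by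
      simpa using (((EuclideanSpace.proj i : EuclideanSpace ℝ (Fin N) →L[ℝ] ℝ).hasFDerivAt (x := z)).const_smul t).const_add (x i)
    have h4 := h3.mul h2
    have h5 : HasFDerivAt (g i) _ z := h4
    refine ⟨h5.differentiableAt, ?_⟩
    rw [h5.fderiv]
    have he : (e i) i = 1 := by simp [e]
    simp [he, hinner, p, p2]
    ring
  have hk : ∀ i, Integrable (fun z => w (‖z‖ ^ 2) * (z i * g i z)) ∧
      Integrable (fun z => W z * (t * (p z + (x i + t * z i) ^ 2 * p2 z))) ∧
      ∫ z, w (‖z‖ ^ 2) * (z i * g i z) = ∫ z, W z * (t * (p z + (x i + t * z i) ^ 2 * p2 z)) := by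
    intro i
    have hfW : ∀ z, fderiv ℝ W z (e i) = - (w (‖z‖ ^ 2) * z i) := by
      intro z
      rw [(hWd z).fderiv]
      simp [hinner]
      ring
    have hcoord : ∀ j : Fin N, Continuous fun z : EuclideanSpace ℝ (Fin N) => z j := by
      intro j; fun_prop
    have hci := hcoord i
    have hgc : ContinuousOn (g i) (Metric.closedBall 0 R) := by
      apply ContinuousOn.mul _ hpc
      fun_prop
    have i1 : Integrable (fun z => w (‖z‖ ^ 2) * (z i * g i z)) := by
      apply integ_ball R
      · have : Continuous fun z : EuclideanSpace ℝ (Fin N) => w (‖z‖ ^ 2) := by fun_prop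
        exact this.continuousOn.mul (hci.continuousOn.mul hgc)
      · intro z hz; rw [hwR' z hz.le, zero_mul]
    have i2 : Integrable (fun z => W z * (t * (p z + (x i + t * z i) ^ 2 * p2 z))) := by
      apply integ_ball R
      · refine hWc.continuousOn.mul (continuousOn_const.mul (hpc.add (ContinuousOn.mul ?_ hp2c)))
        fun_prop
      · intro z hz; rw [hWR z hz.le, zero_mul]
    have hcongr : ∀ z, W z * fderiv ℝ (g i) z (e i) =
        W z * (t * (p z + (x i + t * z i) ^ 2 * p2 z)) := by
      intro z
      by_cases hz : ‖z‖ ≤ R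
      · rw [(hgd i z hz).2]
      · rw [hWR z (le_of_not_ge hz)]; simp
    refine ⟨i1, i2, ?_⟩
    have := integral_mul_fderiv_eq_neg_fderiv_mul_of_integrable (μ := volume) (f := W) (g := g i)
      (v := e i) ?_ ?_ ?_ ?_ ?_
    · simp_rw [hcongr] at this
      rw [this, ← integral_neg]
      congr 1; ext z; rw [hfW]; ring
    · refine i1.neg.congr (Eventually.of_forall fun z => ?_)
      simp only [Pi.neg_apply, hfW]; ring
    · simp_rw [hcongr]; exact i2
    · apply integ_ball R
      · exact hWc.continuousOn.mul hgc
      · intro z hz; rw [hWR z hz.le, zero_mul]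
    · intro z _; exact (hWd z).differentiableAt
    · intro z hz; exact (hgd i z (by simpa using hWts hz)).1
  have hsum : ∀ z : EuclideanSpace ℝ (Fin N), w (‖z‖ ^ 2) *
      (-α * inner ℝ z (x + t • z) * (‖x + t • z‖ ^ 2) ^ (-α / 2 - 1)) =
      ∑ i, w (‖z‖ ^ 2) * (z i * g i z) := by
    intro z
    rw [← Finset.mul_sum]
    congr 1
    have : inner ℝ z (x + t • z) = ∑ i, z i * (x i + t * z i) := by
      simp [PiLp.inner_apply, mul_comm]
    rw [this]
    simp only [g, p]
    rw [Finset.mul_sum, Finset.sum_mul]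
    refine Finset.sum_congr rfl fun i _ => by ring
  simp_rw [hsum]
  rw [integral_finsetSum _ fun i _ => (hk i).1, Finset.sum_congr rfl fun i _ => (hk i).2.2,
    ← integral_finsetSum _ fun i _ => (hk i).2.1]
  apply integral_nonneg
  intro z
  by_cases hz : ‖z‖ ≤ R
  · simp only [Pi.zero_apply]
    rw [← Finset.mul_sum, ← Finset.mul_sum, Finset.sum_add_distrib, ← Finset.sum_mul _ _ (p2 z)]
    have hn : ∑ i, (x i + t * z i) ^ 2 = ‖x + t • z‖ ^ 2 := by
      rw [EuclideanSpace.norm_sq_eq]; simp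
    rw [hn]
    have hpp := hpos z hz
    have h1 : ‖x + t • z‖ ^ 2 * p2 z = α * (α + 2) * (‖x + t • z‖ ^ 2) ^ (-α / 2 - 1) := by
      simp only [p2]
      rw [Real.rpow_sub_one hpp.ne' (-α / 2 - 1)]
      generalize ‖x + t • z‖ ^ 2 = Y at hpp ⊢
      field_simp
    rw [h1]
    refine mul_nonneg (hV0 _) (mul_nonneg ht ?_)
    have : ∑ i : Fin N, p z + α * (α + 2) * (‖x + t • z‖ ^ 2) ^ (-α / 2 - 1) =
      α * (α + 2 - N) * (‖x + t • z‖ ^ 2) ^ (-α / 2 - 1) := by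
      simp [p]; ring
    rw [this]
    have : 0 ≤ α + 2 - N := by linarith
    positivity
  · simp [hWR z (le_of_not_ge hz)]

set_option maxHeartbeats 1000000 in
lemma A2 {N : ℕ} (α : ℝ) (hα0 : 0 ≤ α) (hα : (N : ℝ) - 2 ≤ α) (R : ℝ) (hR : 0 < R)
    (x : EuclideanSpace ℝ (Fin N)) (hx : R < ‖x‖)
    (w : ℝ → ℝ) (hw : Continuous w) (hw0 : ∀ u, 0 ≤ w u)
    (hwR : ∀ u, R ^ 2 ≤ u → w u = 0) :
    ∫ z : EuclideanSpace ℝ (Fin N), w (‖z‖ ^ 2) * (‖x‖ ^ (-α) - ‖x + z‖ ^ (-α)) ≤ 0 := by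
  obtain ⟨c, hc1, hcx⟩ : ∃ c : ℝ, 1 < c ∧ c * R < ‖x‖ := by
    have : 1 < ‖x‖ / R := by rwa [lt_div_iff₀ hR, one_mul]
    obtain ⟨c, h1, h2⟩ := exists_between this
    exact ⟨c, h1, by rwa [lt_div_iff₀ hR] at h2⟩
  have hne : ∀ t : ℝ, |t| ≤ c → ∀ z : EuclideanSpace ℝ (Fin N), ‖z‖ ≤ R → x + t • z ≠ 0 := by
    intro t ht z hz h
    have h1 : x = -(t • z) := eq_neg_of_add_eq_zero_left h
    have h2 : ‖x‖ ≤ c * R := by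
      rw [h1, norm_neg, norm_smul, Real.norm_eq_abs]
      gcongr
    linarith
  have hpos : ∀ t : ℝ, |t| ≤ c → ∀ z : EuclideanSpace ℝ (Fin N), ‖z‖ ≤ R → 0 < ‖x + t • z‖ ^ 2 := by
    intro t ht z hz
    have := norm_pos_iff.2 (hne t ht z hz)
    positivity
  have hwR' : ∀ z : EuclideanSpace ℝ (Fin N), R ≤ ‖z‖ → w (‖z‖ ^ 2) = 0 := fun z hz => hwR _ (by gcongr)
  have hwc : Continuous fun z : EuclideanSpace ℝ (Fin N) => w (‖z‖ ^ 2) := by fun_prop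
  let F : ℝ → EuclideanSpace ℝ (Fin N) → ℝ := fun t z => w (‖z‖ ^ 2) * (‖x + t • z‖ ^ 2) ^ (-α / 2)
  let F' : ℝ → EuclideanSpace ℝ (Fin N) → ℝ := fun t z => w (‖z‖ ^ 2) *
      (-α * inner ℝ z (x + t • z) * (‖x + t • z‖ ^ 2) ^ (-α / 2 - 1))
  have hFint : ∀ t : ℝ, |t| ≤ c → Integrable (F t) := by
    intro t ht
    apply integ_ball R
    · refine hwc.continuousOn.mul (ContinuousOn.rpow_const (by fun_prop) ?_)
      intro z hz
      exact Or.inl (hpos t ht z (by simpa using hz)).ne'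
    · intro z hz; simp only [F]; rw [hwR' z hz.le, zero_mul]
  have hF'cont : ContinuousOn (fun q : ℝ × EuclideanSpace ℝ (Fin N) => F' q.1 q.2)
      (Set.Icc (-c) c ×ˢ Metric.closedBall 0 R) := by
    refine ContinuousOn.mul (by fun_prop) (ContinuousOn.mul (by fun_prop) (ContinuousOn.rpow_const (by fun_prop) ?_))
    rintro ⟨t, z⟩ ⟨ht, hz⟩
    exact Or.inl (hpos t (abs_le.2 ht) z (by simpa using hz)).ne'
  have hF'int : ∀ t : ℝ, |t| ≤ c → Integrable (F' t) := by
    intro t ht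
    apply integ_ball R
    · exact hF'cont.comp (f := fun z => (t, z)) (by fun_prop) (fun z hz => ⟨abs_le.1 ht, hz⟩)
    · intro z hz; simp only [F']; rw [hwR' z hz.le, zero_mul]
  obtain ⟨C, hC⟩ := (isCompact_Icc.prod (isCompact_closedBall (0 : EuclideanSpace ℝ (Fin N)) R)).exists_bound_of_continuousOn hF'cont
  have hder : ∀ t ∈ Set.Ioo (-c) c, HasDerivAt (fun t => ∫ z, F t z) (∫ z, F' t z) t := by
    intro t ht
    have htc : |t| ≤ c := abs_le.2 ⟨ht.1.le, ht.2.le⟩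
    refine (hasDerivAt_integral_of_dominated_loc_of_deriv_le (Ioo_mem_nhds ht.1 ht.2)
      (bound := (Metric.closedBall (0 : EuclideanSpace ℝ (Fin N)) R).indicator fun _ => C)
      (F := F) (F' := F') ?_ (hFint t htc) (hF'int t htc).1 ?_ ?_ ?_).2
    · filter_upwards [Ioo_mem_nhds ht.1 ht.2] with u hu
      exact (hFint u (abs_le.2 ⟨hu.1.le, hu.2.le⟩)).1
    · refine Eventually.of_forall fun z u hu => ?_
      by_cases hz : z ∈ Metric.closedBall (0 : EuclideanSpace ℝ (Fin N)) R
      · rw [Set.indicator_of_mem hz]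
        exact hC (u, z) ⟨⟨hu.1.le, hu.2.le⟩, hz⟩
      · rw [Set.indicator_of_notMem hz]
        have : R < ‖z‖ := by simpa using hz
        simp only [F']
        rw [hwR' z this.le, zero_mul, norm_zero]
    · rw [integrable_indicator_iff Metric.isClosed_closedBall.measurableSet]
      exact integrableOn_const (measure_closedBall_lt_top).ne
    · refine Eventually.of_forall fun z u hu => ?_
      by_cases hz : ‖z‖ ≤ R
      · have h0 : HasDerivAt (fun u : ℝ => x + u • z) z u := by
          simpa using ((hasDerivAt_id u).smul_const z).const_add x
        have h1 := (h0.norm_sq.rpow_const (p := -α / 2) (Or.inl (hpos u (abs_le.2 ⟨hu.1.le, hu.2.le⟩) z hz).ne')).const_mul (w (‖z‖ ^ 2))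
        refine h1.congr_deriv ?_
        simp only [F']
        rw [real_inner_comm]
        ring
      · have h0 := hwR' z (le_of_not_ge hz)
        simp only [F, F', h0, zero_mul]
        exact hasDerivAt_const _ _
  have hsub : Set.Icc (0:ℝ) 1 ⊆ Set.Ioo (-c) c := fun t ht => ⟨by linarith [ht.1], by linarith [ht.2]⟩
  have hmono : MonotoneOn (fun t => ∫ z, F t z) (Set.Icc 0 1) := by
    apply monotoneOn_of_deriv_nonneg (convex_Icc 0 1)
    · exact fun t ht => (hder t (hsub ht)).continuousAt.continuousWithinAt
    · exact fun t ht => (hder t (hsub (interior_subset ht))).differentiableAt.differentiableWithinAt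
    · intro t ht
      have ht' := hsub (interior_subset ht)
      rw [(hder t ht').deriv]
      exact A1 α hα0 hα R hR x t (interior_subset ht).1 (hne t (abs_le.2 ⟨ht'.1.le, ht'.2.le⟩)) w hw hw0 hwR
  have h01 := hmono (Set.left_mem_Icc.2 zero_le_one) (Set.right_mem_Icc.2 zero_le_one) zero_le_one
  have hrp : ∀ y : EuclideanSpace ℝ (Fin N), (‖y‖ ^ 2) ^ (-α / 2) = ‖y‖ ^ (-α) := by
    intro y
    rw [← Real.rpow_natCast, ← Real.rpow_mul (norm_nonneg y)]
    congr 1; push_cast; ring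
  have hc0 : |(0:ℝ)| ≤ c := by simp; linarith
  have hc1' : |(1:ℝ)| ≤ c := by simp; linarith
  have : ∫ z : EuclideanSpace ℝ (Fin N), w (‖z‖ ^ 2) * (‖x‖ ^ (-α) - ‖x + z‖ ^ (-α)) =
      (∫ z, F 0 z) - ∫ z, F 1 z := by
    rw [← integral_sub (hFint 0 hc0) (hFint 1 hc1')]
    congr 1; ext z
    simp only [F, hrp, zero_smul, one_smul, add_zero]
    ring
  rw [this]
  simpa using h01

lemma gs_nonneg (N : ℕ) (s R : ℝ) (hR : 0 < R) (x : EuclideanSpace ℝ (Fin N)) :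
    0 ≤ Gammastar N s R x := le_min (by positivity) (by positivity)

lemma gs_le (N : ℕ) (s R : ℝ) (x : EuclideanSpace ℝ (Fin N)) :
    Gammastar N s R x ≤ R ^ (-((N : ℝ) - 2 * s)) := min_le_right _ _

lemma gs_le_G (N : ℕ) (s R : ℝ) (x : EuclideanSpace ℝ (Fin N)) :
    Gammastar N s R x ≤ ‖x‖ ^ (-((N : ℝ) - 2 * s)) := min_le_left _ _

lemma gs_eq (N : ℕ) (s R : ℝ) (hN : 2 * s < N) (hR : 0 < R) (x : EuclideanSpace ℝ (Fin N))
    (hx : R ≤ ‖x‖) :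
    Gammastar N s R x = ‖x‖ ^ (-((N : ℝ) - 2 * s)) :=
  min_eq_left (Real.rpow_le_rpow_of_nonpos hR hx (by linarith))

lemma gs_meas (N : ℕ) (s R : ℝ) : Measurable (Gammastar N s R) := by
  unfold Gammastar
  fun_prop

/-- The excess of the fundamental solution over its truncation. -/
def PP (N : ℕ) (s R : ℝ) (x : EuclideanSpace ℝ (Fin N)) : ℝ :=
  ‖x‖ ^ (-((N : ℝ) - 2 * s)) - Gammastar N s R x

lemma PP_nonneg (N : ℕ) (s R : ℝ) (x : EuclideanSpace ℝ (Fin N)) : 0 ≤ PP N s R x :=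
  sub_nonneg.2 (gs_le_G N s R x)

lemma PP_zero (N : ℕ) (s R : ℝ) (hN : 2 * s < N) (hR : 0 < R) (x : EuclideanSpace ℝ (Fin N))
    (hx : R ≤ ‖x‖) : PP N s R x = 0 := by
  rw [PP, gs_eq N s R hN hR x hx, sub_self]

lemma PP_meas (N : ℕ) (s R : ℝ) : Measurable (PP N s R) := by
  unfold PP
  exact Measurable.sub (by fun_prop) (gs_meas N s R)

lemma G_int (N : ℕ) (s r : ℝ) (hs0 : 0 < s) (hN : 2 * s < N) :
    IntegrableOn (fun y : EuclideanSpace ℝ (Fin N) => ‖y‖ ^ (-((N : ℝ) - 2 * s)))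
      (Metric.ball 0 r) := by
  have hN1 : 1 ≤ N := by
    have : (0:ℝ) < N := by linarith
    exact_mod_cast this
  refine integrableOn_ball_of_norm_le_rpow (C := 1) (α := (N : ℝ) - 2 * s) ?_ ?_ ?_ ?_
  · simpa using hN1
  · simp; linarith
  · refine Eventually.of_forall fun y => ?_
    rw [one_mul, Real.norm_of_nonneg (by positivity)]
  · exact Measurable.aestronglyMeasurable (by fun_prop)

lemma PP_int (N : ℕ) (s R : ℝ) (hs0 : 0 < s) (hN : 2 * s < N) (hR : 0 < R) :
    Integrable (PP N s R) := by
  rw [← integrableOn_iff_integrable_of_support_subset (s := Metric.ball 0 R)]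
  · refine (G_int N s R hs0 hN).mono' (PP_meas N s R).aestronglyMeasurable
      (Eventually.of_forall fun y => ?_)
    rw [Real.norm_of_nonneg (PP_nonneg N s R y)]
    exact sub_le_self _ (gs_nonneg N s R hR y)
  · intro y hy
    by_contra h
    exact hy (PP_zero N s R hN hR y (by simpa using h))

/-- The kernel away from the origin. -/
def tail (N : ℕ) (q δ : ℝ) (z : EuclideanSpace ℝ (Fin N)) : ℝ :=
  {z : EuclideanSpace ℝ (Fin N) | δ ≤ ‖z‖}.indicator (fun z => ‖z‖ ^ (-q)) z

lemma tail_nonneg (N : ℕ) (q δ : ℝ) (z : EuclideanSpace ℝ (Fin N)) : 0 ≤ tail N q δ z :=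
  Set.indicator_nonneg (fun _ _ => by positivity) _

lemma tail_meas (N : ℕ) (q δ : ℝ) : Measurable (tail N q δ) := by
  unfold tail
  exact Measurable.indicator (by fun_prop) (measurableSet_le (by fun_prop) (by fun_prop))

lemma tail_eq (N : ℕ) (q δ : ℝ) (z : EuclideanSpace ℝ (Fin N)) (hz : δ ≤ ‖z‖) :
    tail N q δ z = ‖z‖ ^ (-q) := Set.indicator_of_mem (s := {z : EuclideanSpace ℝ (Fin N) | δ ≤ ‖z‖}) hz _

lemma tail_neg (N : ℕ) (q δ : ℝ) (z : EuclideanSpace ℝ (Fin N)) :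
    tail N q δ (-z) = tail N q δ z := by
  simp [tail, Set.indicator]

lemma tail_int (N : ℕ) (q δ : ℝ) (hδ : 0 < δ) (hq : (N : ℝ) < q) : Integrable (tail N q δ) := by
  have h := (integrable_one_add_norm (E := EuclideanSpace ℝ (Fin N)) (μ := volume) (r := q)
    (by simpa using hq)).const_mul ((1 + 1 / δ) ^ q)
  have hq0 : 0 < q := lt_of_le_of_lt (Nat.cast_nonneg N) hq
  refine h.mono' (tail_meas N q δ).aestronglyMeasurable (Eventually.of_forall fun z => ?_)
  rw [Real.norm_of_nonneg (tail_nonneg N q δ z)]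
  by_cases hz : δ ≤ ‖z‖
  · rw [tail_eq N q δ z hz]
    have hz0 : 0 < ‖z‖ := lt_of_lt_of_le hδ hz
    have h1 : 1 + ‖z‖ ≤ (1 + 1 / δ) * ‖z‖ := by
      have : 1 ≤ 1 / δ * ‖z‖ := by
        rw [one_div, inv_mul_eq_div, le_div_iff₀ hδ]; linarith
      linarith
    have h2 : (1 + ‖z‖) ^ q ≤ (1 + 1 / δ) ^ q * ‖z‖ ^ q := by
      rw [← Real.mul_rpow (by positivity) (by positivity)]
      exact Real.rpow_le_rpow (by positivity) h1 hq0.le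
    rw [Real.rpow_neg (by positivity), Real.rpow_neg (by positivity), ← div_eq_mul_inv,
      le_div_iff₀ (by positivity), inv_mul_eq_div, div_le_iff₀ (by positivity)]
    exact h2
  · have : tail N q δ z = 0 := Set.indicator_of_notMem (s := {z : EuclideanSpace ℝ (Fin N) | δ ≤ ‖z‖}) hz _
    rw [this]; positivity

lemma Pk_int (N : ℕ) (s R : ℝ) (hs0 : 0 < s) (hN : 2 * s < N) (hR : 0 < R)
    (x : EuclideanSpace ℝ (Fin N)) (hx : R < ‖x‖) :
    Integrable fun y => PP N s R y * ‖x - y‖ ^ (-((N : ℝ) + 2 * s)) := by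
  refine ((PP_int N s R hs0 hN hR).mul_const ((‖x‖ - R) ^ (-((N : ℝ) + 2 * s)))).mono'
    (Measurable.aestronglyMeasurable ((PP_meas N s R).mul (by fun_prop)))
    (Eventually.of_forall fun y => ?_)
  have hP := PP_nonneg N s R y
  rw [Real.norm_of_nonneg (by positivity)]
  by_cases hy : R ≤ ‖y‖
  · rw [PP_zero N s R hN hR y hy]; simp
  · have hy' := not_le.1 hy
    have h1 : ‖x‖ - R ≤ ‖x - y‖ := by have := norm_sub_norm_le x y; linarith
    gcongr ?_ * ?_
    exact Real.rpow_le_rpow_of_nonpos (by linarith) h1 (by linarith)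

/-- Cut-off region, symmetric under swaps and under inversions. -/
def DD (N : ℕ) (l : ℝ) : Set (EuclideanSpace ℝ (Fin N) × EuclideanSpace ℝ (Fin N)) :=
  {p | l * ‖p.2‖ < ‖p.1‖ ∨ l * ‖p.1‖ < ‖p.2‖}

lemma DD_meas (N : ℕ) (l : ℝ) : MeasurableSet (DD N l) := by
  unfold DD
  exact MeasurableSet.union (s₁ := {p : EuclideanSpace ℝ (Fin N) × EuclideanSpace ℝ (Fin N) | l * ‖p.2‖ < ‖p.1‖})
    (s₂ := {p : EuclideanSpace ℝ (Fin N) × EuclideanSpace ℝ (Fin N) | l * ‖p.1‖ < ‖p.2‖})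
    (measurableSet_lt (by fun_prop) (by fun_prop)) (measurableSet_lt (by fun_prop) (by fun_prop))

set_option maxHeartbeats 1000000 in
lemma innerA (N : ℕ) (s R : ℝ) (hs0 : 0 < s) (hN : 2 * s < N) (hR : 0 < R)
    (x : EuclideanSpace ℝ (Fin N)) (l : ℝ) (hl : 1 < l) (hx : l * R ≤ ‖x‖) :
    ∫ y, (Gammastar N s R x - Gammastar N s R y) *
      ((DD N l).indicator (fun _ => (1 : ℝ)) (x, y) * ‖x - y‖ ^ (-((N : ℝ) + 2 * s))) =
    ∫ y, PP N s R y * ‖x - y‖ ^ (-((N : ℝ) + 2 * s)) := by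
  have hRx : R < ‖x‖ := by nlinarith
  have hr : 0 < ‖x‖ := by linarith
  have hN1 : 0 < N := by
    have : (0:ℝ) < N := by linarith
    exact_mod_cast this
  have hinv := inv_identity N hN1 ((N : ℝ) - 2 * s) ((N : ℝ) + 2 * s) (by ring) x
    (norm_pos_iff.1 hr) l hl
  set O : Set (EuclideanSpace ℝ (Fin N)) := {y | l * ‖x‖ < ‖y‖} with hO
  set I : Set (EuclideanSpace ℝ (Fin N)) := {y | l * ‖y‖ < ‖x‖} with hI
  have hOm : MeasurableSet O := measurableSet_lt (by fun_prop) (by fun_prop)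
  have hIm : MeasurableSet I := measurableSet_lt (by fun_prop) (by fun_prop)
  set f : EuclideanSpace ℝ (Fin N) → ℝ := fun y =>
    (‖x‖ ^ (-((N : ℝ) - 2 * s)) - ‖y‖ ^ (-((N : ℝ) - 2 * s))) * ‖x - y‖ ^ (-((N : ℝ) + 2 * s)) with hf
  have hfm : Measurable f := by fun_prop
  have hfO : IntegrableOn f O := by
    have h1 := ((tail_int N ((N : ℝ) + 2 * s) ((l - 1) * ‖x‖) (mul_pos (by linarith) hr)
      (by linarith)).comp_sub_left x).const_mul (‖x‖ ^ (-((N : ℝ) - 2 * s)))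
    refine h1.integrableOn.mono' hfm.aestronglyMeasurable ?_
    refine (ae_restrict_iff' hOm).2 (Eventually.of_forall fun y hy => ?_)
    have hy' : l * ‖x‖ < ‖y‖ := hy
    have h2 : (l - 1) * ‖x‖ ≤ ‖x - y‖ := by
      have := norm_sub_norm_le y x
      rw [norm_sub_rev] at this
      linarith
    rw [tail_eq _ _ _ _ h2]
    have h3 : ‖y‖ ^ (-((N : ℝ) - 2 * s)) ≤ ‖x‖ ^ (-((N : ℝ) - 2 * s)) :=
      Real.rpow_le_rpow_of_nonpos hr (by nlinarith) (by linarith)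
    have h4 : 0 ≤ ‖y‖ ^ (-((N : ℝ) - 2 * s)) := by positivity
    simp only [hf]
    rw [Real.norm_of_nonneg (mul_nonneg (by linarith) (by positivity))]
    gcongr
    linarith
  have hfI : IntegrableOn f I := by
    have hsub : I ⊆ Metric.ball 0 ‖x‖ := by
      intro y hy
      have hy' : l * ‖y‖ < ‖x‖ := hy
      have := norm_nonneg y
      simp; nlinarith
    have h1 : IntegrableOn (fun y : EuclideanSpace ℝ (Fin N) => (‖x‖ ^ (-((N : ℝ) - 2 * s)) + ‖y‖ ^ (-((N : ℝ) - 2 * s))) * (‖x‖ - ‖x‖ / l) ^ (-((N : ℝ) + 2 * s))) (Metric.ball 0 ‖x‖) :=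
      ((integrableOn_const (measure_ball_lt_top).ne).add (G_int N s ‖x‖ hs0 hN)).mul_const _
    refine (h1.mono_set hsub).mono' hfm.aestronglyMeasurable ?_
    refine (ae_restrict_iff' hIm).2 (Eventually.of_forall fun y hy => ?_)
    have hy' : l * ‖y‖ < ‖x‖ := hy
    have hy2 : ‖y‖ ≤ ‖x‖ / l := by rw [le_div_iff₀ (by linarith)]; linarith
    have h2 : ‖x‖ - ‖x‖ / l ≤ ‖x - y‖ := by
      have := norm_sub_norm_le x y; linarith
    have h3 : 0 < ‖x‖ - ‖x‖ / l := by
      rw [sub_pos, div_lt_iff₀ (by linarith)]; nlinarith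
    have h4 : 0 ≤ ‖y‖ ^ (-((N : ℝ) - 2 * s)) := by positivity
    have h5 : 0 ≤ ‖x‖ ^ (-((N : ℝ) - 2 * s)) := by positivity
    simp only [hf]
    rw [norm_mul, Real.norm_of_nonneg (r := ‖x - y‖ ^ (-((N : ℝ) + 2 * s))) (by positivity)]
    gcongr ?_ * ?_
    · rw [Real.norm_eq_abs, abs_le]; constructor <;> linarith
    · exact Real.rpow_le_rpow_of_nonpos h3 h2 (by linarith)
  have hpt : ∀ y, (Gammastar N s R x - Gammastar N s R y) *
      ((DD N l).indicator (fun _ => (1 : ℝ)) (x, y) * ‖x - y‖ ^ (-((N : ℝ) + 2 * s))) =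
      I.indicator f y + O.indicator f y + PP N s R y * ‖x - y‖ ^ (-((N : ℝ) + 2 * s)) := by
    intro y
    rw [gs_eq N s R hN hR x hRx.le]
    have hy0 := norm_nonneg y
    by_cases h1 : l * ‖y‖ < ‖x‖
    · have h2 : ¬ l * ‖x‖ < ‖y‖ := by nlinarith
      rw [Set.indicator_of_mem (show y ∈ I from h1), Set.indicator_of_notMem (show y ∉ O from h2),
        Set.indicator_of_mem (show (x, y) ∈ DD N l from Or.inl h1)]
      simp only [hf, PP]; ring
    · have hyR : R ≤ ‖y‖ := by
        have : l * R ≤ l * ‖y‖ := by linarith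
        exact le_of_mul_le_mul_left this (by linarith)
      rw [Set.indicator_of_notMem (show y ∉ I from h1), PP_zero N s R hN hR y hyR,
        gs_eq N s R hN hR y hyR]
      by_cases h2 : l * ‖x‖ < ‖y‖
      · rw [Set.indicator_of_mem (show y ∈ O from h2),
          Set.indicator_of_mem (show (x, y) ∈ DD N l from Or.inr h2)]
        simp only [hf]; ring
      · rw [Set.indicator_of_notMem (show y ∉ O from h2),
          Set.indicator_of_notMem (show (x, y) ∉ DD N l from not_or.2 ⟨h1, h2⟩)]
        ring
  simp_rw [hpt]
  have i1 := hfI.integrable_indicator hIm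
  have i2 := hfO.integrable_indicator hOm
  have i3 : Integrable fun y => I.indicator f y + O.indicator f y := i1.add i2
  rw [integral_add i3 (Pk_int N s R hs0 hN hR x hRx)]
  have h' : ∫ y, (I.indicator f y + O.indicator f y) = 0 := by
    have h := integral_add i1 i2
    rw [integral_indicator hIm, integral_indicator hOm, hinv] at h
    rw [h]
    exact neg_add_cancel _
  rw [h', zero_add]

set_option maxHeartbeats 1000000 in
lemma innerB (N : ℕ) (s R : ℝ) (hs0 : 0 < s) (hs1 : s < 1) (hN : 2 * s < N) (hR : 0 < R)
    (x : EuclideanSpace ℝ (Fin N)) (hx : R < ‖x‖)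
    (w : ℝ → ℝ) (hw : Continuous w) (hw0 : ∀ u, 0 ≤ w u)
    (hwR : ∀ u, R ^ 2 ≤ u → w u = 0)
    (hwk : ∀ z : EuclideanSpace ℝ (Fin N), w (‖z‖ ^ 2) ≤ ‖z‖ ^ (-((N : ℝ) + 2 * s))) :
    ∫ y, (Gammastar N s R x - Gammastar N s R y) * w (‖x - y‖ ^ 2) ≤
    ∫ y, PP N s R y * ‖x - y‖ ^ (-((N : ℝ) + 2 * s)) := by
  have hA := A2 ((N : ℝ) - 2 * s) (by linarith) (by linarith) R hR x hx w hw hw0 hwR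
  have hwR' : ∀ z : EuclideanSpace ℝ (Fin N), R ≤ ‖z‖ → w (‖z‖ ^ 2) = 0 := fun z hz => hwR _ (by gcongr)
  have hwc : Continuous fun z : EuclideanSpace ℝ (Fin N) => w (‖z‖ ^ 2) := by fun_prop
  have i1 : Integrable fun z => w (‖z‖ ^ 2) * (‖x‖ ^ (-((N : ℝ) - 2 * s)) - ‖x + z‖ ^ (-((N : ℝ) - 2 * s))) := by
    apply integ_ball R
    · refine hwc.continuousOn.mul (continuousOn_const.sub (ContinuousOn.rpow_const (by fun_prop) ?_))
      intro z hz
      left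
      have hz' : ‖z‖ ≤ R := by simpa using hz
      have := norm_sub_le_norm_add x z
      have : 0 < ‖x + z‖ := by linarith
      exact this.ne'
    · intro z hz; rw [hwR' z hz.le, zero_mul]
  have iPk : Integrable fun z => PP N s R (x + z) * ‖x - (x + z)‖ ^ (-((N : ℝ) + 2 * s)) :=
    (Pk_int N s R hs0 hN hR x hx).comp_add_left x
  have hle : ∀ z, PP N s R (x + z) * w (‖z‖ ^ 2) ≤ PP N s R (x + z) * ‖x - (x + z)‖ ^ (-((N : ℝ) + 2 * s)) := by
    intro z
    have e : ‖x - (x + z)‖ = ‖z‖ := by simp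
    rw [e]
    exact mul_le_mul_of_nonneg_left (hwk z) (PP_nonneg _ _ _ _)
  have i2 : Integrable fun z => PP N s R (x + z) * w (‖z‖ ^ 2) := by
    refine iPk.mono' (Measurable.aestronglyMeasurable (Measurable.mul ?_ hwc.measurable)) (Eventually.of_forall fun z => ?_)
    · exact (PP_meas N s R).comp (by fun_prop)
    · rw [Real.norm_of_nonneg (mul_nonneg (PP_nonneg _ _ _ _) (hw0 _))]
      exact hle z
  rw [← integral_add_left_eq_self (fun y => (Gammastar N s R x - Gammastar N s R y) * w (‖x - y‖ ^ 2)) x,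
    ← integral_add_left_eq_self (fun y => PP N s R y * ‖x - y‖ ^ (-((N : ℝ) + 2 * s))) x]
  calc _ = ∫ z, (w (‖z‖ ^ 2) * (‖x‖ ^ (-((N : ℝ) - 2 * s)) - ‖x + z‖ ^ (-((N : ℝ) - 2 * s))) +
        PP N s R (x + z) * w (‖z‖ ^ 2)) := by
        congr 1; ext z
        have e : ‖x - (x + z)‖ = ‖z‖ := by simp
        rw [e, gs_eq N s R hN hR x hx.le, PP]; ring
    _ = _ := integral_add i1 i2
    _ ≤ 0 + ∫ z, PP N s R (x + z) * ‖x - (x + z)‖ ^ (-((N : ℝ) + 2 * s)) :=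
        add_le_add hA (integral_mono i2 iPk hle)
    _ = _ := zero_add _

lemma gf_int (N : ℕ) (s R : ℝ) (hs0 : 0 < s) (hR : 0 < R)
    (φ : EuclideanSpace ℝ (Fin N) → ℝ) (hφm : Measurable φ) (hφ : Integrable φ)
    (m : EuclideanSpace ℝ (Fin N) × EuclideanSpace ℝ (Fin N) → ℝ) (hm : Measurable m)
    (δ : ℝ) (hδ : 0 < δ)
    (hmt : ∀ p, φ p.1 ≠ 0 → |m p| ≤ tail N ((N : ℝ) + 2 * s) δ (p.1 - p.2)) :
    Integrable fun p : EuclideanSpace ℝ (Fin N) × EuclideanSpace ℝ (Fin N) =>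
      φ p.1 * ((Gammastar N s R p.1 - Gammastar N s R p.2) * m p) := by
  have h1 := (Integrable.convolution_integrand (ContinuousLinearMap.mul ℝ ℝ) hφ
    (tail_int N ((N : ℝ) + 2 * s) δ hδ (by linarith))).swap
  have h2 : Integrable fun p : EuclideanSpace ℝ (Fin N) × EuclideanSpace ℝ (Fin N) =>
      φ p.1 * tail N ((N : ℝ) + 2 * s) δ (p.1 - p.2) := by
    refine h1.congr (Eventually.of_forall fun p => ?_)
    simp only [Function.comp, Prod.fst_swap, Prod.snd_swap, ContinuousLinearMap.mul_apply']
    rw [← neg_sub p.1 p.2, tail_neg]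
  have hg := gs_meas N s R
  refine (h2.norm.const_mul (R ^ (-((N : ℝ) - 2 * s)))).mono'
    (Measurable.aestronglyMeasurable (by fun_prop)) (Eventually.of_forall fun p => ?_)
  by_cases h : φ p.1 = 0
  · simp [h]
  · have hmp := hmt p h
    have hg1 := gs_nonneg N s R hR p.1
    have hg2 := gs_nonneg N s R hR p.2
    have hg3 := gs_le N s R p.1
    have hg4 := gs_le N s R p.2
    have hd : |Gammastar N s R p.1 - Gammastar N s R p.2| ≤ R ^ (-((N : ℝ) - 2 * s)) := by
      rw [abs_le]; constructor <;> linarith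
    rw [norm_mul, norm_mul, norm_mul, Real.norm_of_nonneg (tail_nonneg _ _ _ _)]
    simp only [Real.norm_eq_abs]
    calc |φ p.1| * (|Gammastar N s R p.1 - Gammastar N s R p.2| * |m p|)
        ≤ |φ p.1| * (R ^ (-((N : ℝ) - 2 * s)) * tail N ((N : ℝ) + 2 * s) δ (p.1 - p.2)) := by gcongr
      _ = _ := by ring

lemma sym_int {E : Type*} [MeasureSpace E] [SFinite (volume : Measure E)]
    (u φ : E → ℝ) (m : E × E → ℝ) (hm : ∀ p, m p.swap = m p)
    (hi : Integrable fun p : E × E => φ p.1 * ((u p.1 - u p.2) * m p)) :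
    ∫ p : E × E, (u p.1 - u p.2) * (φ p.1 - φ p.2) * m p =
      2 * ∫ x, φ x * ∫ y, (u x - u y) * m (x, y) := by
  have h1 : ∀ p : E × E, (u p.1 - u p.2) * (φ p.1 - φ p.2) * m p =
      (fun p : E × E => φ p.1 * ((u p.1 - u p.2) * m p)) p +
      (fun p : E × E => φ p.1 * ((u p.1 - u p.2) * m p)) p.swap := by
    intro p
    simp only [Prod.fst_swap, Prod.snd_swap, hm]
    ring
  simp_rw [h1]
  have hi' : Integrable (fun p : E × E => (fun p : E × E => φ p.1 * ((u p.1 - u p.2) * m p)) p.swap) := hi.swap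
  rw [integral_add hi hi']
  have h2 := integral_prod_swap (μ := (volume : Measure E)) (ν := (volume : Measure E))
    (fun p : E × E => φ p.1 * ((u p.1 - u p.2) * m p))
  have h3 := integral_prod (μ := (volume : Measure E)) (ν := (volume : Measure E)) _ hi
  simp only [integral_const_mul] at h3
  rw [Measure.volume_eq_prod, h2, h3]
  ring

lemma lim_int {X : Type*} [MeasureSpace X] (F : X → ℝ) (hF : Integrable F)
    (c : ℕ → X → ℝ) (hc : ∀ n, Measurable (c n)) (hc01 : ∀ n x, c n x ∈ Set.Icc (0:ℝ) 1)
    (hlim : ∀ᵐ x, F x = 0 ∨ ∀ᶠ n in atTop, c n x = 1) :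
    Tendsto (fun n => ∫ x, c n x * F x) atTop (𝓝 (∫ x, F x)) := by
  refine tendsto_integral_of_dominated_convergence (fun x => ‖F x‖) (fun n => (hc n).aestronglyMeasurable.mul hF.1)
    hF.norm (fun n => Eventually.of_forall fun x => ?_) ?_
  · rw [norm_mul, Real.norm_of_nonneg (hc01 n x).1]
    exact mul_le_of_le_one_left (norm_nonneg _) (hc01 n x).2
  · filter_upwards [hlim] with x hx
    rcases hx with h | h
    · simp [h]
    · refine tendsto_const_nhds.congr' ?_
      filter_upwards [h] with n hn
      rw [hn, one_mul]

lemma norm_eq_null (N : ℕ) (hN : 0 < N) :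
    ∀ᵐ p : EuclideanSpace ℝ (Fin N) × EuclideanSpace ℝ (Fin N), ‖p.1‖ ≠ ‖p.2‖ := by
  have : Nonempty (Fin N) := ⟨⟨0, hN⟩⟩
  have hm : MeasurableSet {p : EuclideanSpace ℝ (Fin N) × EuclideanSpace ℝ (Fin N) | ‖p.1‖ = ‖p.2‖} :=
    measurableSet_eq_fun (by fun_prop) (by fun_prop)
  have h0 : volume {p : EuclideanSpace ℝ (Fin N) × EuclideanSpace ℝ (Fin N) | ‖p.1‖ = ‖p.2‖} = 0 := by
    rw [Measure.volume_eq_prod, Measure.measure_prod_null hm]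
    refine Eventually.of_forall fun x => ?_
    have : (Prod.mk x ⁻¹' {p : EuclideanSpace ℝ (Fin N) × EuclideanSpace ℝ (Fin N) | ‖p.1‖ = ‖p.2‖}) =
        Metric.sphere 0 ‖x‖ := by
      ext y; simp [eq_comm]
    change volume (Prod.mk x ⁻¹' {p : EuclideanSpace ℝ (Fin N) × EuclideanSpace ℝ (Fin N) | ‖p.1‖ = ‖p.2‖}) = 0
    rw [this]
    exact Measure.addHaar_sphere _ _ _
  rw [ae_iff]
  simpa using h0

lemma supp_gap {N : ℕ} (R : ℝ) (φ : EuclideanSpace ℝ (Fin N) → ℝ) (hφ_supp : HasCompactSupport φ)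
    (hφ_loc : tsupport φ ⊆ {x : EuclideanSpace ℝ (Fin N) | R < ‖x‖}) :
    ∃ R', R < R' ∧ ∀ x, φ x ≠ 0 → R' ≤ ‖x‖ := by
  rcases (tsupport φ).eq_empty_or_nonempty with h | h
  · refine ⟨R + 1, by linarith, fun x hx => ?_⟩
    have : x ∈ tsupport φ := subset_tsupport φ hx
    rw [h] at this
    exact this.elim
  · obtain ⟨x0, hx0, hmin⟩ := IsCompact.exists_isMinOn hφ_supp h (f := fun x => ‖x‖) (by fun_prop)
    exact ⟨‖x0‖, hφ_loc hx0, fun x hx => hmin (subset_tsupport φ hx)⟩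

/-- Continuous cut-off function of the radius. -/
def chi (n : ℕ) (r : ℝ) : ℝ := min 1 (max 0 (((n : ℝ) + 1) * r - 1))

lemma chi_mem (n : ℕ) (r : ℝ) : chi n r ∈ Set.Icc (0:ℝ) 1 :=
  ⟨le_min zero_le_one (le_max_left _ _), min_le_left _ _⟩

lemma chi_cont (n : ℕ) : Continuous (chi n) := by unfold chi; fun_prop

lemma chi_zero (n : ℕ) (r : ℝ) (h : r ≤ 1 / ((n : ℝ) + 1)) : chi n r = 0 := by
  unfold chi
  have : ((n : ℝ) + 1) * r ≤ 1 := by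
    rw [le_div_iff₀ (by positivity)] at h; linarith
  rw [max_eq_left (by linarith)]
  simp

lemma chi_one (r : ℝ) (h : 0 < r) : ∀ᶠ n : ℕ in atTop, chi n r = 1 := by
  filter_upwards [eventually_ge_atTop (⌈2 / r⌉₊)] with n hn
  have h1 : 2 / r ≤ n := Nat.ceil_le.1 hn
  rw [div_le_iff₀ h] at h1
  unfold chi
  rw [min_eq_left]
  exact le_trans (by nlinarith) (le_max_right _ _)

lemma chi_mul (n : ℕ) (r q : ℝ) :
    chi n r * (max r (1 / ((n : ℝ) + 1))) ^ q = chi n r * r ^ q := by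
  rcases le_total r (1 / ((n : ℝ) + 1)) with h | h
  · simp [chi_zero n r h]
  · rw [max_eq_left h]

lemma stepA (N : ℕ) (s R : ℝ) (hs0 : 0 < s) (hN : 2 * s < N) (hR : 0 < R)
    (φ : EuclideanSpace ℝ (Fin N) → ℝ) (hφm : Measurable φ) (hφ : Integrable φ)
    (l : ℝ) (hl : 1 < l) (hx : ∀ x, φ x ≠ 0 → l * R ≤ ‖x‖) :
    (Integrable fun x => φ x * ∫ y, PP N s R y * ‖x - y‖ ^ (-((N : ℝ) + 2 * s))) ∧
    ∫ p : EuclideanSpace ℝ (Fin N) × EuclideanSpace ℝ (Fin N),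
      (DD N l).indicator (fun _ => (1 : ℝ)) p *
        ((Gammastar N s R p.1 - Gammastar N s R p.2) * (φ p.1 - φ p.2) *
          ‖p.1 - p.2‖ ^ (-((N : ℝ) + 2 * s))) =
      2 * ∫ x, φ x * ∫ y, PP N s R y * ‖x - y‖ ^ (-((N : ℝ) + 2 * s)) := by
  set m : EuclideanSpace ℝ (Fin N) × EuclideanSpace ℝ (Fin N) → ℝ := fun p =>
    (DD N l).indicator (fun _ => (1 : ℝ)) p * ‖p.1 - p.2‖ ^ (-((N : ℝ) + 2 * s)) with hm
  have hmm : Measurable m :=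
    (measurable_const.indicator (DD_meas N l)).mul (by fun_prop)
  have hms : ∀ p, m p.swap = m p := by
    intro p
    have h1 : (p.swap ∈ DD N l) ↔ p ∈ DD N l := by
      simp only [DD, Set.mem_ofPred_eq, Prod.fst_swap, Prod.snd_swap]
      exact or_comm
    simp only [hm, Prod.fst_swap, Prod.snd_swap, norm_sub_rev p.2 p.1]
    congr 1
    by_cases h : p ∈ DD N l
    · rw [Set.indicator_of_mem h, Set.indicator_of_mem (h1.2 h)]
    · rw [Set.indicator_of_notMem h, Set.indicator_of_notMem (fun h' => h (h1.1 h'))]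
  have hgi := gf_int N s R hs0 hR φ hφm hφ m hmm ((l - 1) * R) (mul_pos (by linarith) hR) (by
    intro p hp
    have hxp := hx p.1 hp
    by_cases h : p ∈ DD N l
    · have hd : (l - 1) * R ≤ ‖p.1 - p.2‖ := by
        rcases h with h | h
        · have h1 := norm_sub_norm_le p.1 p.2
          have h2 : (l - 1) * (l * R) ≤ (l - 1) * ‖p.1‖ :=
            mul_le_mul_of_nonneg_left hxp (by linarith)
          have h3 : l * ((l - 1) * R) ≤ l * ‖p.1 - p.2‖ := by nlinarith
          exact le_of_mul_le_mul_left h3 (by linarith)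
        · have h1 := norm_sub_norm_le p.2 p.1
          rw [norm_sub_rev] at h1
          have h2 : R ≤ ‖p.1‖ := by nlinarith
          have h3 : (l - 1) * R ≤ (l - 1) * ‖p.1‖ :=
            mul_le_mul_of_nonneg_left h2 (by linarith)
          linarith
      rw [tail_eq _ _ _ _ hd]
      simp only [hm]
      rw [Set.indicator_of_mem h, one_mul, abs_of_nonneg (by positivity)]
    · simp only [hm]
      rw [Set.indicator_of_notMem h, zero_mul, abs_zero]
      exact tail_nonneg _ _ _ _)
  have hinner : ∀ x, φ x * ∫ y, (Gammastar N s R x - Gammastar N s R y) * m (x, y) =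
      φ x * ∫ y, PP N s R y * ‖x - y‖ ^ (-((N : ℝ) + 2 * s)) := by
    intro x
    by_cases h : φ x = 0
    · simp [h]
    · rw [← innerA N s R hs0 hN hR x l hl (hx x h)]
  constructor
  · have h := hgi.integral_prod_left
    refine h.congr (Eventually.of_forall fun x => ?_)
    simp only
    rw [integral_const_mul]
    exact hinner x
  · have h := sym_int (Gammastar N s R) φ m hms hgi
    simp_rw [hinner] at h
    rw [← h]
    congr 1
    ext p
    simp only [hm]
    ring

lemma J1 (N : ℕ) (s R : ℝ) (hs0 : 0 < s) (hN : 2 * s < N) (hR : 0 < R)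
    (φ : EuclideanSpace ℝ (Fin N) → ℝ) (hφm : Measurable φ) (hφ : Integrable φ)
    (R' : ℝ) (hR' : R < R') (hx : ∀ x, φ x ≠ 0 → R' ≤ ‖x‖)
    (hF : Integrable fun p : EuclideanSpace ℝ (Fin N) × EuclideanSpace ℝ (Fin N) =>
      (Gammastar N s R p.1 - Gammastar N s R p.2) * (φ p.1 - φ p.2) *
          ‖p.1 - p.2‖ ^ (-((N : ℝ) + 2 * s))) :
    (Integrable fun x => φ x * ∫ y, PP N s R y * ‖x - y‖ ^ (-((N : ℝ) + 2 * s))) ∧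
    ∫ p : EuclideanSpace ℝ (Fin N) × EuclideanSpace ℝ (Fin N),
        ((Gammastar N s R p.1 - Gammastar N s R p.2) * (φ p.1 - φ p.2) *
          ‖p.1 - p.2‖ ^ (-((N : ℝ) + 2 * s))) =
      2 * ∫ x, φ x * ∫ y, PP N s R y * ‖x - y‖ ^ (-((N : ℝ) + 2 * s)) := by
  have hN1 : 0 < N := by
    have : (0:ℝ) < N := by linarith
    exact_mod_cast this
  set c : ℝ := R' / R - 1 with hc
  have hc0 : 0 < c := by
    rw [hc, sub_pos, lt_div_iff₀ hR]; linarith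
  have hcR : (1 + c) * R = R' := by rw [hc]; field_simp; ring
  set l : ℕ → ℝ := fun n => 1 + c / ((n : ℝ) + 1) with hl
  have hl1 : ∀ n, 1 < l n := by
    intro n
    have : 0 < c / ((n : ℝ) + 1) := by positivity
    simp only [hl]; linarith
  have hl2 : ∀ n, l n * R ≤ R' := by
    intro n
    have : c / ((n : ℝ) + 1) ≤ c := div_le_self hc0.le (by linarith [Nat.cast_nonneg (α := ℝ) n])
    rw [← hcR]
    simp only [hl]
    gcongr
  have hll : Tendsto l atTop (𝓝 1) := by
    have h := (tendsto_one_div_add_atTop_nhds_zero_nat (𝕜 := ℝ)).const_mul c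
    have h2 := h.const_add 1
    simp only [mul_zero, add_zero, mul_one_div] at h2
    exact h2
  have hA := fun n => stepA N s R hs0 hN hR φ hφm hφ (l n) (hl1 n) (fun x h => (hl2 n).trans (hx x h))
  refine ⟨(hA 0).1, ?_⟩
  have hlim := lim_int _ hF (fun n => (DD N (l n)).indicator (fun _ => (1 : ℝ)))
    (fun n => measurable_const.indicator (DD_meas N (l n))) (by
      intro n p
      by_cases h : p ∈ DD N (l n)
      · rw [Set.indicator_of_mem h]; simp
      · rw [Set.indicator_of_notMem h]; simp) (by
      filter_upwards [norm_eq_null N hN1] with p hp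
      right
      rcases lt_or_gt_of_ne hp with h | h
      · have ht := hll.mul_const ‖p.1‖
        rw [one_mul] at ht
        filter_upwards [ht.eventually (gt_mem_nhds h)] with n hn
        exact Set.indicator_of_mem (show p ∈ DD N (l n) from Or.inr hn) _
      · have ht := hll.mul_const ‖p.2‖
        rw [one_mul] at ht
        filter_upwards [ht.eventually (gt_mem_nhds h)] with n hn
        exact Set.indicator_of_mem (show p ∈ DD N (l n) from Or.inl hn) _)
  refine tendsto_nhds_unique hlim ?_
  refine tendsto_const_nhds.congr fun n => ?_
  exact (hA n).2.symm

lemma stepB (N : ℕ) (s R : ℝ) (hs0 : 0 < s) (hs1 : s < 1) (hN : 2 * s < N) (hR : 0 < R)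
    (a : EuclideanSpace ℝ (Fin N) → ℝ) (hac : Continuous a)
    (ha_radial : ∀ x y : EuclideanSpace ℝ (Fin N), ‖x‖ = ‖y‖ → a x = a y)
    (ha_01 : ∀ x, a x ∈ Set.Icc (0 : ℝ) 1)
    (ha_out : ∀ x : EuclideanSpace ℝ (Fin N), R ≤ ‖x‖ → a x = 1)
    (φ : EuclideanSpace ℝ (Fin N) → ℝ) (hφm : Measurable φ) (hφ : Integrable φ)
    (hφ0 : ∀ x, 0 ≤ φ x) (hx : ∀ x, φ x ≠ 0 → R < ‖x‖)
    (hE : Integrable fun x => φ x * ∫ y, PP N s R y * ‖x - y‖ ^ (-((N : ℝ) + 2 * s)))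
    (n : ℕ) :
    ∫ p : EuclideanSpace ℝ (Fin N) × EuclideanSpace ℝ (Fin N),
      chi n ‖p.1 - p.2‖ *
        ((Gammastar N s R p.1 - Gammastar N s R p.2) * (φ p.1 - φ p.2) *
          ((1 - a (p.1 - p.2)) * ‖p.1 - p.2‖ ^ (-((N : ℝ) + 2 * s)))) ≤
      2 * ∫ x, φ x * ∫ y, PP N s R y * ‖x - y‖ ^ (-((N : ℝ) + 2 * s)) := by
  have hN1 : 0 < N := by
    have : (0:ℝ) < N := by linarith
    exact_mod_cast this
  set e : EuclideanSpace ℝ (Fin N) := EuclideanSpace.single ⟨0, hN1⟩ (1:ℝ) with he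
  have hen : ‖e‖ = 1 := by simp [he]
  set w : ℝ → ℝ := fun u => (1 - a (√u • e)) *
    (chi n (√u) * (max (√u) (1 / ((n : ℝ) + 1))) ^ (-((N : ℝ) + 2 * s))) with hw
  have hpos : (0:ℝ) < 1 / ((n : ℝ) + 1) := by positivity
  have hwc : Continuous w := by
    have hchi := chi_cont n
    refine Continuous.mul (by fun_prop) (Continuous.mul (by fun_prop) ?_)
    refine Continuous.rpow_const (by fun_prop) fun u => Or.inl ?_
    exact (lt_of_lt_of_le hpos (le_max_right _ _)).ne'
  have hae : ∀ u, ‖√u • e‖ = √u := by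
    intro u
    rw [norm_smul, hen, mul_one, Real.norm_of_nonneg (Real.sqrt_nonneg u)]
  have hw0 : ∀ u, 0 ≤ w u := by
    intro u
    refine mul_nonneg (by linarith [(ha_01 (√u • e)).2]) (mul_nonneg (chi_mem n _).1 ?_)
    exact Real.rpow_nonneg (hpos.le.trans (le_max_right _ _)) _
  have hwR : ∀ u, R ^ 2 ≤ u → w u = 0 := by
    intro u hu
    have : a (√u • e) = 1 := ha_out _ (by rw [hae]; exact Real.le_sqrt_of_sq_le hu)
    simp only [hw, this, sub_self, zero_mul]
  have hwz : ∀ z : EuclideanSpace ℝ (Fin N), w (‖z‖ ^ 2) =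
      (1 - a z) * (chi n ‖z‖ * ‖z‖ ^ (-((N : ℝ) + 2 * s))) := by
    intro z
    have h1 : √(‖z‖ ^ 2) = ‖z‖ := Real.sqrt_sq (norm_nonneg z)
    have h2 : a (‖z‖ • e) = a z := ha_radial _ _ (by rw [← h1, hae, h1])
    simp only [hw]
    rw [h1, h2, chi_mul]
  have hwk : ∀ z : EuclideanSpace ℝ (Fin N), w (‖z‖ ^ 2) ≤ ‖z‖ ^ (-((N : ℝ) + 2 * s)) := by
    intro z
    rw [hwz, ← mul_assoc]
    have h1 := ha_01 z
    have h2 := chi_mem n ‖z‖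
    have h3 : (1 - a z) * chi n ‖z‖ ≤ 1 :=
      mul_le_one₀ (by linarith [h1.1]) h2.1 h2.2
    exact mul_le_of_le_one_left (by positivity) h3
  set m : EuclideanSpace ℝ (Fin N) × EuclideanSpace ℝ (Fin N) → ℝ := fun p =>
    w (‖p.1 - p.2‖ ^ 2) with hm
  have hmm : Measurable m := by
    have : Continuous m := by fun_prop
    exact this.measurable
  have hms : ∀ p, m p.swap = m p := by
    intro p
    simp only [hm, Prod.fst_swap, Prod.snd_swap, norm_sub_rev p.2 p.1]
  have hgi := gf_int N s R hs0 hR φ hφm hφ m hmm (1 / ((n : ℝ) + 1)) hpos (by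
    intro p _
    simp only [hm]
    rw [abs_of_nonneg (hw0 _)]
    rcases le_total (1 / ((n : ℝ) + 1)) ‖p.1 - p.2‖ with h | h
    · rw [tail_eq _ _ _ _ h]
      exact hwk _
    · rw [hwz, chi_zero n _ h, zero_mul, mul_zero]
      exact tail_nonneg _ _ _ _)
  have hI : Integrable fun x => φ x * ∫ y, (Gammastar N s R x - Gammastar N s R y) * m (x, y) := by
    refine hgi.integral_prod_left.congr (Eventually.of_forall fun x => ?_)
    simp only
    rw [integral_const_mul]
  have h := sym_int (Gammastar N s R) φ m hms hgi
  calc _ = ∫ p : EuclideanSpace ℝ (Fin N) × EuclideanSpace ℝ (Fin N),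
        (Gammastar N s R p.1 - Gammastar N s R p.2) * (φ p.1 - φ p.2) * m p := by
        congr 1
        ext p
        simp only [hm]
        rw [hwz]; ring
    _ = _ := h
    _ ≤ _ := by
      refine mul_le_mul_of_nonneg_left ?_ (by norm_num)
      refine integral_mono hI hE fun x => ?_
      simp only
      by_cases h : φ x = 0
      · simp [h]
      · exact mul_le_mul_of_nonneg_left
          (innerB N s R hs0 hs1 hN hR x (hx x h) w hwc hw0 hwR hwk) (hφ0 x)

lemma J2 (N : ℕ) (s R : ℝ) (hs0 : 0 < s) (hs1 : s < 1) (hN : 2 * s < N) (hR : 0 < R)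
    (a : EuclideanSpace ℝ (Fin N) → ℝ) (hac : Continuous a)
    (ha_radial : ∀ x y : EuclideanSpace ℝ (Fin N), ‖x‖ = ‖y‖ → a x = a y)
    (ha_01 : ∀ x, a x ∈ Set.Icc (0 : ℝ) 1)
    (ha_out : ∀ x : EuclideanSpace ℝ (Fin N), R ≤ ‖x‖ → a x = 1)
    (φ : EuclideanSpace ℝ (Fin N) → ℝ) (hφm : Measurable φ) (hφ : Integrable φ)
    (hφ0 : ∀ x, 0 ≤ φ x) (hx : ∀ x, φ x ≠ 0 → R < ‖x‖)
    (hE : Integrable fun x => φ x * ∫ y, PP N s R y * ‖x - y‖ ^ (-((N : ℝ) + 2 * s)))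
    (hF : Integrable fun p : EuclideanSpace ℝ (Fin N) × EuclideanSpace ℝ (Fin N) =>
        (Gammastar N s R p.1 - Gammastar N s R p.2) * (φ p.1 - φ p.2) *
          ((1 - a (p.1 - p.2)) * ‖p.1 - p.2‖ ^ (-((N : ℝ) + 2 * s)))) :
    ∫ p : EuclideanSpace ℝ (Fin N) × EuclideanSpace ℝ (Fin N),
        ((Gammastar N s R p.1 - Gammastar N s R p.2) * (φ p.1 - φ p.2) *
          ((1 - a (p.1 - p.2)) * ‖p.1 - p.2‖ ^ (-((N : ℝ) + 2 * s)))) ≤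
      2 * ∫ x, φ x * ∫ y, PP N s R y * ‖x - y‖ ^ (-((N : ℝ) + 2 * s)) := by
  have hlim := lim_int _ hF (fun n p => chi n ‖p.1 - p.2‖)
    (fun n => by
      have hchi := chi_cont n
      exact Continuous.measurable (by fun_prop)) (fun n p => chi_mem n _)
    (Eventually.of_forall fun p => by
      by_cases h : p.1 = p.2
      · left
        simp [h]
      · right
        exact chi_one _ (norm_pos_iff.2 (sub_ne_zero.2 h)))
  exact le_of_tendsto' hlim fun n =>
    stepB N s R hs0 hs1 hN hR a hac ha_radial ha_01 ha_out φ hφm hφ hφ0 hx hE n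


/-- The perturbed kernel `K(z) = (1+a(z))|z|^{−(N+2s)}` satisfies
hypothesis (K5): `Γ*` is a weak supersolution of `L_K` outside `B̄_R`. -/
theorem statement_17 (N : ℕ) (s : ℝ) (hs0 : 0 < s) (hs1 : s < 1) (hN : 2 * s < N)
    (R : ℝ) (hR : 1 < R)
    (a : EuclideanSpace ℝ (Fin N) → ℝ)
    (ha_smooth : ContDiff ℝ (⊤ : ℕ∞) a)
    (ha_radial : ∀ x y : EuclideanSpace ℝ (Fin N), ‖x‖ = ‖y‖ → a x = a y)
    (ha_01 : ∀ x, a x ∈ Set.Icc (0 : ℝ) 1)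
    (ha_in : ∀ x : EuclideanSpace ℝ (Fin N), ‖x‖ ≤ R / 2 → a x = 0)
    (ha_out : ∀ x : EuclideanSpace ℝ (Fin N), R ≤ ‖x‖ → a x = 1)
    (φ : EuclideanSpace ℝ (Fin N) → ℝ)
    (hφ_smooth : ContDiff ℝ (⊤ : ℕ∞) φ) (hφ_supp : HasCompactSupport φ)
    (hφ_loc : tsupport φ ⊆ {x : EuclideanSpace ℝ (Fin N) | R < ‖x‖})
    (hφ_nonneg : ∀ x, 0 ≤ φ x) :
    0 ≤ ∫ z : EuclideanSpace ℝ (Fin N) × EuclideanSpace ℝ (Fin N),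
      (Gammastar N s R z.1 - Gammastar N s R z.2) * (φ z.1 - φ z.2) *
        ((1 + a (z.1 - z.2)) * ‖z.1 - z.2‖ ^ (-((N : ℝ) + 2 * s))) := by
  have hR0 : 0 < R := by linarith
  by_cases hF : Integrable fun z : EuclideanSpace ℝ (Fin N) × EuclideanSpace ℝ (Fin N) =>
      (Gammastar N s R z.1 - Gammastar N s R z.2) * (φ z.1 - φ z.2) *
        ((1 + a (z.1 - z.2)) * ‖z.1 - z.2‖ ^ (-((N : ℝ) + 2 * s)))
  swap
  · rw [integral_undef hF]
  have hφc : Continuous φ := hφ_smooth.continuous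
  have hac : Continuous a := ha_smooth.continuous
  have hφm := hφc.measurable
  have hφi : Integrable φ := hφc.integrable_of_hasCompactSupport hφ_supp
  have hg := gs_meas N s R
  have ham := hac.measurable
  obtain ⟨R', hR', hx⟩ := supp_gap R φ hφ_supp hφ_loc
  have i1 : Integrable fun p : EuclideanSpace ℝ (Fin N) × EuclideanSpace ℝ (Fin N) =>
      (Gammastar N s R p.1 - Gammastar N s R p.2) * (φ p.1 - φ p.2) *
          ‖p.1 - p.2‖ ^ (-((N : ℝ) + 2 * s)) := by
    refine hF.mono (Measurable.aestronglyMeasurable (by fun_prop))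
      (Eventually.of_forall fun p => ?_)
    have h1 := ha_01 (p.1 - p.2)
    rw [norm_mul, norm_mul _ ((1 + a (p.1 - p.2)) * _), norm_mul (1 + a (p.1 - p.2)),
      Real.norm_of_nonneg (r := 1 + a (p.1 - p.2)) (by linarith [h1.1])]
    refine mul_le_mul_of_nonneg_left ?_ (norm_nonneg _)
    exact le_mul_of_one_le_left (norm_nonneg _) (by linarith [h1.1])
  have i2 : Integrable fun p : EuclideanSpace ℝ (Fin N) × EuclideanSpace ℝ (Fin N) =>
      (Gammastar N s R p.1 - Gammastar N s R p.2) * (φ p.1 - φ p.2) *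
          ((1 - a (p.1 - p.2)) * ‖p.1 - p.2‖ ^ (-((N : ℝ) + 2 * s))) := by
    refine hF.mono (Measurable.aestronglyMeasurable (by fun_prop))
      (Eventually.of_forall fun p => ?_)
    have h1 := ha_01 (p.1 - p.2)
    rw [norm_mul, norm_mul _ ((1 + a (p.1 - p.2)) * _), norm_mul (1 + a (p.1 - p.2)),
      norm_mul (1 - a (p.1 - p.2)),
      Real.norm_of_nonneg (r := 1 + a (p.1 - p.2)) (by linarith [h1.1]),
      Real.norm_of_nonneg (r := 1 - a (p.1 - p.2)) (by linarith [h1.2])]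
    refine mul_le_mul_of_nonneg_left ?_ (norm_nonneg _)
    exact mul_le_mul_of_nonneg_right (by linarith [h1.1]) (norm_nonneg _)
  obtain ⟨hE, h1⟩ := J1 N s R hs0 hN hR0 φ hφm hφi R' hR' hx i1
  have h2 := J2 N s R hs0 hs1 hN hR0 a hac ha_radial ha_01 ha_out φ hφm hφi hφ_nonneg
    (fun x h => lt_of_lt_of_le hR' (hx x h)) hE i2
  have hE0 : 0 ≤ ∫ x, φ x * ∫ y, PP N s R y * ‖x - y‖ ^ (-((N : ℝ) + 2 * s)) :=
    integral_nonneg fun x => mul_nonneg (hφ_nonneg x)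
      (integral_nonneg fun y => mul_nonneg (PP_nonneg N s R y) (by positivity))
  have hsplit : ∀ z : EuclideanSpace ℝ (Fin N) × EuclideanSpace ℝ (Fin N),
      (Gammastar N s R z.1 - Gammastar N s R z.2) * (φ z.1 - φ z.2) *
        ((1 + a (z.1 - z.2)) * ‖z.1 - z.2‖ ^ (-((N : ℝ) + 2 * s))) =
      2 * ((Gammastar N s R z.1 - Gammastar N s R z.2) * (φ z.1 - φ z.2) *
          ‖z.1 - z.2‖ ^ (-((N : ℝ) + 2 * s))) -
      (Gammastar N s R z.1 - Gammastar N s R z.2) * (φ z.1 - φ z.2) *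
          ((1 - a (z.1 - z.2)) * ‖z.1 - z.2‖ ^ (-((N : ℝ) + 2 * s))) := fun z => by ring
  simp_rw [hsplit]
  rw [integral_sub (i1.const_mul 2) i2, integral_const_mul, h1]
  linarith
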